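/- Recovery lower bound on Q^ε: Let ε ∈ (0,1) and let Ψ_RABC be a pure state on R×A×B×C. Then Q^ε(Ψ_RABC) ≥ −2·log F(R:C|B)_{Ψ_RBC} + log(1 − ε²), where Ψ_RBC is the marginal of |Ψ⟩⟨Ψ| on R×B×C. -/

import Mathlib

open scoped Kronecker BigOperators
open Matrix
open scoped ComplexOrder Classical

noncomputable section

/-- A density matrix: positive semidefinite with unit trace. -/
def IsDensityMatrix {d : Type*} [Fintype d] (ρ : Matrix d d ℂ) : Prop :=
  ρ.PosSemidef ∧ ρ.trace = 1

/-- Loewner order on Hermitian matrices: `A ≤ B` iff `B - A` is positive semidefinite. -/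
def LoewnerLE {d : Type*} [Fintype d] (A B : Matrix d d ℂ) : Prop := (B - A).PosSemidef

/-- Partial trace over the second tensor factor. -/
def ptrace2 {d₁ d₂ : Type*} [Fintype d₂] (M : Matrix (d₁ × d₂) (d₁ × d₂) ℂ) :
    Matrix d₁ d₁ ℂ :=
  fun i i' => ∑ k, M (i, k) (i', k)

/-- Partial trace over the first tensor factor. -/
def ptrace1 {d₁ d₂ : Type*} [Fintype d₁] (M : Matrix (d₁ × d₂) (d₁ × d₂) ℂ) :
    Matrix d₂ d₂ ℂ :=
  fun j j' => ∑ k, M (k, j) (k, j')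

/-- Functional calculus for Hermitian matrices: apply `f` to the eigenvalues. -/
def hermCFC {d : Type*} [Fintype d] [DecidableEq d] (f : ℝ → ℝ) (A : Matrix d d ℂ) :
    Matrix d d ℂ :=
  if hA : A.IsHermitian then
    (hA.eigenvectorUnitary : Matrix d d ℂ) *
      Matrix.diagonal (fun i => (f (hA.eigenvalues i) : ℂ)) *
      (star (hA.eigenvectorUnitary : Matrix d d ℂ))
  else 0

/-- Matrix logarithm, base 2, applied to nonzero eigenvalues. -/
def matLog2 {d : Type*} [Fintype d] [DecidableEq d] (A : Matrix d d ℂ) : Matrix d d ℂ :=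
  hermCFC (Real.logb 2) A

/-- Positive semidefinite square root (via functional calculus). -/
def matSqrt {d : Type*} [Fintype d] [DecidableEq d] (A : Matrix d d ℂ) : Matrix d d ℂ :=
  hermCFC Real.sqrt A

/-- Support containment: the kernel of `σ` is contained in the kernel of `ρ`. -/
def SupportLE {d : Type*} [Fintype d] (ρ σ : Matrix d d ℂ) : Prop :=
  ∀ v : d → ℂ, σ.mulVec v = 0 → ρ.mulVec v = 0

/-- Relative entropy, base 2, as a real number (meaningful when supports are nested). -/
def relentR {d : Type*} [Fintype d] [DecidableEq d] (ρ σ : Matrix d d ℂ) : ℝ :=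
  ((ρ * matLog2 ρ).trace - (ρ * matLog2 σ).trace).re

/-- Relative entropy `D(ρ‖σ)`, base 2, valued in the extended reals: `+∞` unless
the support of `ρ` is contained in the support of `σ`. -/
def relent {d : Type*} [Fintype d] [DecidableEq d] (ρ σ : Matrix d d ℂ) : EReal :=
  if SupportLE ρ σ then ((relentR ρ σ : ℝ) : EReal) else ⊤

/-- Mutual information `I(A:B)_ρ = D(ρ_AB ‖ ρ_A ⊗ ρ_B)`. -/
def mutInfo {d₁ d₂ : Type*} [Fintype d₁] [Fintype d₂] [DecidableEq d₁] [DecidableEq d₂]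
    (ρ : Matrix (d₁ × d₂) (d₁ × d₂) ℂ) : EReal :=
  relent ρ (ptrace2 ρ ⊗ₖ ptrace1 ρ)

/-- Fidelity `F(ρ,σ) = Tr √(√σ ρ √σ)`. -/
def fidelity {d : Type*} [Fintype d] [DecidableEq d] (ρ σ : Matrix d d ℂ) : ℝ :=
  ((matSqrt (matSqrt σ * ρ * matSqrt σ)).trace).re

/-- Purified distance `P(ρ,σ) = √(1 - F(ρ,σ)²)`. -/
def pdist {d : Type*} [Fintype d] [DecidableEq d] (ρ σ : Matrix d d ℂ) : ℝ :=
  Real.sqrt (1 - (fidelity ρ σ) ^ 2)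

/-- Max-relative entropy `Dmax(ρ‖σ) = inf {λ : ρ ≤ 2^λ σ}`, valued in the extended reals. -/
def dmax {d : Type*} [Fintype d] (ρ σ : Matrix d d ℂ) : EReal :=
  sInf {x : EReal | ∃ l : ℝ, x = (l : EReal) ∧ LoewnerLE ρ (((2 : ℝ) ^ l) • σ)}

/-- Max-information `Imax(A:B)_ρ`. -/
def imax {d₁ d₂ : Type*} [Fintype d₁] [Fintype d₂]
    (ρ : Matrix (d₁ × d₂) (d₁ × d₂) ℂ) : EReal :=
  ⨅ σ : {σ : Matrix d₂ d₂ ℂ // IsDensityMatrix σ}, dmax ρ (ptrace2 ρ ⊗ₖ σ.1)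

/-- Smooth max-information `Imax^ε(A:B)_ρ`. -/
def imaxEps {d₁ d₂ : Type*} [Fintype d₁] [Fintype d₂] [DecidableEq d₁] [DecidableEq d₂]
    (ε : ℝ) (ρ : Matrix (d₁ × d₂) (d₁ × d₂) ℂ) : EReal :=
  ⨅ ρ' : {ρ' : Matrix (d₁ × d₂) (d₁ × d₂) ℂ // IsDensityMatrix ρ' ∧ pdist ρ ρ' ≤ ε},
    imax ρ'.1

/-- The `j`-th term of the convex split: `ρ` on `P` and the `j`-th copy of `Q`, and
`σ` on every other copy of `Q`. -/
def blockState {P Q : Type*} [Fintype Q] [DecidableEq Q]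
    (ρ : Matrix (P × Q) (P × Q) ℂ) (σ : Matrix Q Q ℂ) (n : ℕ) (j : Fin n) :
    Matrix (P × (Fin n → Q)) (P × (Fin n → Q)) ℂ :=
  fun x y => ρ (x.1, x.2 j) (y.1, y.2 j) * ∏ i ∈ Finset.univ.erase j, σ (x.2 i) (y.2 i)

/-- The convex-split state `τ = (1/n) Σ_j ρ_{PQ_j} ⊗ σ_{Q_1} ⊗ ⋯ ⊗ σ_{Q_n}` (omitting `j`). -/
def convexSplit {P Q : Type*} [Fintype Q] [DecidableEq Q]
    (ρ : Matrix (P × Q) (P × Q) ℂ) (σ : Matrix Q Q ℂ) (n : ℕ) :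
    Matrix (P × (Fin n → Q)) (P × (Fin n → Q)) ℂ :=
  ((n : ℂ)⁻¹) • ∑ j : Fin n, blockState ρ σ n j

/-- A finite nonempty index type. -/
structure FinIdx where
  carrier : Type
  [fin : Fintype carrier]
  [deq : DecidableEq carrier]
  [ne : Nonempty carrier]

attribute [instance] FinIdx.fin FinIdx.deq FinIdx.ne

section Qeps

variable {R A B C : Type} [Fintype R] [Fintype A] [Fintype B] [Fintype C]
  [DecidableEq R] [DecidableEq A] [DecidableEq B] [DecidableEq C]

/-- Reindexing `(R×B)×(C×T) ≃ R×((B×C)×T)`. -/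
def eRBCT (R B C T : Type) : (R × B) × (C × T) ≃ R × ((B × C) × T) :=
  (Equiv.prodAssoc R B (C × T)).trans
    (Equiv.prodCongr (Equiv.refl R) (Equiv.prodAssoc B C T).symm)

/-- The quantity `Q^ε(Ψ_RABC)` from Anshu–Devabathini–Jain: the infimum, over finite
nonempty index types `T`, unitaries `U` on `B×C×T`, density matrices `σ'` on `T`,
density matrices `σCT` on `C×T`, and density matrices `κ` on `(R×B)×(C×T)` with
`κ_RB = Ψ_RB` and `(1⊗U)·κ·(1⊗U)† ∈ B^ε(Ψ_RBC ⊗ σ')`, of `Dmax(κ ‖ κ_RB ⊗ σCT)`.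
Here `ψ` is a unit vector on `(R×(B×C))×A` describing the pure state `Ψ_RABC`. -/
def Qeps (ε : ℝ) (ψ : (R × (B × C)) × A → ℂ) : EReal :=
  ⨅ (T : FinIdx)
    (U : Matrix.unitaryGroup ((B × C) × T.carrier) ℂ)
    (σ' : {m : Matrix T.carrier T.carrier ℂ // IsDensityMatrix m})
    (σCT : {m : Matrix (C × T.carrier) (C × T.carrier) ℂ // IsDensityMatrix m})
    (κ : {m : Matrix ((R × B) × (C × T.carrier)) ((R × B) × (C × T.carrier)) ℂ //
            IsDensityMatrix m})
    (_ : ptrace2 κ.1 =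
          ptrace2 (Matrix.reindex (Equiv.prodAssoc R B C).symm (Equiv.prodAssoc R B C).symm
            (ptrace2 (Matrix.vecMulVec ψ (star ψ)))))
    (_ : IsDensityMatrix
            (((1 : Matrix R R ℂ) ⊗ₖ U.1) *
              (Matrix.reindex (eRBCT R B C T.carrier) (eRBCT R B C T.carrier) κ.1) *
              ((1 : Matrix R R ℂ) ⊗ₖ U.1)ᴴ) ∧
         pdist
            (Matrix.reindex (Equiv.prodAssoc R (B × C) T.carrier)
              (Equiv.prodAssoc R (B × C) T.carrier)
              ((ptrace2 (Matrix.vecMulVec ψ (star ψ))) ⊗ₖ σ'.1))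
            (((1 : Matrix R R ℂ) ⊗ₖ U.1) *
              (Matrix.reindex (eRBCT R B C T.carrier) (eRBCT R B C T.carrier) κ.1) *
              ((1 : Matrix R R ℂ) ⊗ₖ U.1)ᴴ) ≤ ε),
    dmax κ.1 (ptrace2 κ.1 ⊗ₖ σCT.1)

end Qeps
section Channel

variable {R B C : Type} [Fintype R] [Fintype B] [Fintype C]
  [DecidableEq R] [DecidableEq B] [DecidableEq C]

/-- Application of the quantum channel with Kraus operators `K i : B → B×C` to the
`B` factor of a matrix on `R × B`, i.e. `(id_R ⊗ E)(X)`. -/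
def applyChannelR {ι : Type} [Fintype ι]
    (K : ι → Matrix (B × C) B ℂ) (X : Matrix (R × B) (R × B) ℂ) :
    Matrix (R × (B × C)) (R × (B × C)) ℂ :=
  ∑ i, ((1 : Matrix R R ℂ) ⊗ₖ K i) * X * ((1 : Matrix R R ℂ) ⊗ₖ K i)ᴴ

/-- The `R × B` marginal of a state on `R × (B × C)`. -/
def margRB (ρ : Matrix (R × (B × C)) (R × (B × C)) ℂ) : Matrix (R × B) (R × B) ℂ :=
  ptrace2 (Matrix.reindex (Equiv.prodAssoc R B C).symm (Equiv.prodAssoc R B C).symm ρ)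

/-- Fidelity of recovery `F(R:C|B)_ρ`: the supremum over quantum channels
`E : B → B×C` of `F(ρ_RBC, (id_R ⊗ E)(ρ_RB))`. -/
def fidRecovery (ρ : Matrix (R × (B × C)) (R × (B × C)) ℂ) : ℝ :=
  sSup {x : ℝ | ∃ (ι : FinIdx) (K : ι.carrier → Matrix (B × C) B ℂ),
    (∑ i, (K i)ᴴ * K i) = 1 ∧ x = fidelity ρ (applyChannelR K (margRB ρ))}

end Channel

section HermitianCalculus

variable {d : Type*} [Fintype d] [DecidableEq d]

lemma hermCFC_mul (f g : ℝ → ℝ) (A : Matrix d d ℂ) :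
    hermCFC f A * hermCFC g A = hermCFC (fun x => f x * g x) A := by
  unfold hermCFC
  split_ifs with hA
  · have hU : star (hA.eigenvectorUnitary : Matrix d d ℂ) *
        (hA.eigenvectorUnitary : Matrix d d ℂ) = 1 := Unitary.coe_star_mul_self _
    simp only [Matrix.mul_assoc]
    rw [← Matrix.mul_assoc (star (hA.eigenvectorUnitary : Matrix d d ℂ)), hU, Matrix.one_mul,
      ← Matrix.mul_assoc (Matrix.diagonal _), Matrix.diagonal_mul_diagonal]
    simp
  · simp

lemma hermCFC_isHermitian (f : ℝ → ℝ) (A : Matrix d d ℂ) : (hermCFC f A).IsHermitian := by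
  unfold hermCFC
  split_ifs with hA
  · apply Matrix.isHermitian_mul_mul_conjTranspose
    rw [Matrix.isHermitian_diagonal_iff]
    intro i
    simp [isSelfAdjoint_iff]
  · exact Matrix.isHermitian_zero

lemma hermCFC_congr {f g : ℝ → ℝ} {A : Matrix d d ℂ} (hA : A.PosSemidef)
    (h : ∀ x, 0 ≤ x → f x = g x) : hermCFC f A = hermCFC g A := by
  have hfg : ∀ i, f (hA.1.eigenvalues i) = g (hA.1.eigenvalues i) :=
    fun i => h _ (hA.eigenvalues_nonneg i)
  simp only [hermCFC, dif_pos hA.1, hfg]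

lemma hermCFC_posSemidef {f : ℝ → ℝ} (hf : ∀ x, 0 ≤ f x) (A : Matrix d d ℂ) :
    (hermCFC f A).PosSemidef := by
  unfold hermCFC
  split_ifs with hA
  · apply Matrix.PosSemidef.mul_mul_conjTranspose_same
    apply Matrix.PosSemidef.diagonal
    intro i
    simpa using hf _
  · exact Matrix.PosSemidef.zero

lemma hermCFC_id {A : Matrix d d ℂ} (hA : A.IsHermitian) : hermCFC (fun x => x) A = A := by
  rw [hermCFC, dif_pos hA]
  exact hA.spectral_theorem.symm

lemma hermCFC_one {A : Matrix d d ℂ} (hA : A.IsHermitian) : hermCFC (fun _ => 1) A = 1 := by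
  rw [hermCFC, dif_pos hA]
  simp

lemma hermCFC_sub (f g : ℝ → ℝ) (A : Matrix d d ℂ) :
    hermCFC f A - hermCFC g A = hermCFC (fun x => f x - g x) A := by
  unfold hermCFC
  split_ifs with hA
  · rw [← Matrix.sub_mul, ← Matrix.mul_sub, Matrix.diagonal_sub]
    simp
  · simp

lemma trace_hermCFC (f : ℝ → ℝ) {A : Matrix d d ℂ} (hA : A.IsHermitian) :
    (hermCFC f A).trace = ∑ i, (f (hA.eigenvalues i) : ℂ) := by
  rw [hermCFC, dif_pos hA, Matrix.trace_mul_comm, ← Matrix.mul_assoc]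
  simp [Matrix.trace_diagonal]

lemma conjTranspose_eigenvectorUnitary_mul_mul {A : Matrix d d ℂ} (hA : A.IsHermitian) :
    (hA.eigenvectorUnitary : Matrix d d ℂ)ᴴ * A * (hA.eigenvectorUnitary : Matrix d d ℂ) =
      Matrix.diagonal (fun i => (hA.eigenvalues i : ℂ)) := by
  have h := hA.conjStarAlgAut_star_eigenvectorUnitary
  rw [Unitary.conjStarAlgAut_star_apply] at h
  exact h

lemma matSqrt_mul_self {A : Matrix d d ℂ} (hA : A.PosSemidef) : matSqrt A * matSqrt A = A := by
  rw [matSqrt, hermCFC_mul, hermCFC_congr hA (fun x hx => Real.mul_self_sqrt hx),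
    hermCFC_id hA.1]

lemma matSqrt_isHermitian (A : Matrix d d ℂ) : (matSqrt A).IsHermitian :=
  hermCFC_isHermitian _ A

/-- Pseudo-inverse of the positive semidefinite square root. -/
def matSqrtInv (A : Matrix d d ℂ) : Matrix d d ℂ :=
  hermCFC (fun x => (Real.sqrt x)⁻¹) A

lemma matSqrtInv_isHermitian (A : Matrix d d ℂ) : (matSqrtInv A).IsHermitian :=
  hermCFC_isHermitian _ A

lemma one_sub_hermCFC_posSemidef {f : ℝ → ℝ} (hf : ∀ x, f x ≤ 1) {A : Matrix d d ℂ}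
    (hA : A.IsHermitian) : (1 - hermCFC f A).PosSemidef := by
  rw [← hermCFC_one hA, hermCFC_sub]
  exact hermCFC_posSemidef (fun x => sub_nonneg.2 (hf x)) A

lemma matSqrtInv_mul_mul_matSqrtInv_le_one {A : Matrix d d ℂ} (hA : A.PosSemidef) :
    (1 - matSqrtInv A * A * matSqrtInv A).PosSemidef := by
  have h : matSqrtInv A * A * matSqrtInv A =
      hermCFC (fun x => (Real.sqrt x)⁻¹ * x * (Real.sqrt x)⁻¹) A := by
    conv_lhs => rw [← hermCFC_id hA.1]
    simp only [matSqrtInv, hermCFC_id hA.1]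
    conv_lhs => enter [1, 2]; rw [← hermCFC_id hA.1]
    rw [hermCFC_mul, hermCFC_mul]
  rw [h]
  refine one_sub_hermCFC_posSemidef (fun x => ?_) hA.1
  rcases le_or_gt x 0 with hx | hx
  · simp [Real.sqrt_eq_zero_of_nonpos hx]
  · have := Real.sqrt_pos.2 hx
    have h2 := Real.mul_self_sqrt hx.le
    apply le_of_eq
    field_simp
    nlinarith

end HermitianCalculus

section FidelityBlocks

variable {d : Type*} [Fintype d] [DecidableEq d]

lemma fidelity_eq_sum {ρ σ : Matrix d d ℂ}
    (h : (matSqrt σ * ρ * matSqrt σ).IsHermitian) :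
    fidelity ρ σ = ∑ i, Real.sqrt (h.eigenvalues i) := by
  rw [fidelity, matSqrt, trace_hermCFC _ h]
  simp

lemma posSemidef_matSqrt_conj {ρ : Matrix d d ℂ} (hρ : ρ.PosSemidef) (σ : Matrix d d ℂ) :
    (matSqrt σ * ρ * matSqrt σ).PosSemidef := by
  have := hρ.mul_mul_conjTranspose_same (matSqrt σ)
  rwa [(matSqrt_isHermitian σ).eq] at this

/-- The fidelity is attained as the trace of an off-diagonal block. -/
lemma exists_block_trace_eq_fidelity {ρ σ : Matrix d d ℂ} (hρ : ρ.PosSemidef)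
    (hσ : σ.PosSemidef) :
    ∃ X : Matrix d d ℂ, (Matrix.fromBlocks ρ X Xᴴ σ).PosSemidef ∧
      X.trace.re = fidelity ρ σ := by
  set s := matSqrt σ with hs
  set M := s * ρ * s with hM
  have hMp : M.PosSemidef := posSemidef_matSqrt_conj hρ σ
  have hsH : sᴴ = s := matSqrt_isHermitian σ
  set N := matSqrtInv M with hN
  have hNH : Nᴴ = N := matSqrtInv_isHermitian M
  set Z := s * N * s with hZ
  have hZH : Zᴴ = Z := by simp [hZ, hsH, hNH, Matrix.mul_assoc]
  refine ⟨ρ * Z, ?_, ?_⟩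
  · have h1 : (Matrix.fromBlocks ρ (ρ * Z) (Z * ρ) (Z * ρ * Z)).PosSemidef := by
      have := hρ.mul_mul_conjTranspose_same (Matrix.fromRows (1 : Matrix d d ℂ) Z)
      rw [Matrix.conjTranspose_fromRows_eq_fromCols_conjTranspose, Matrix.fromRows_mul,
        Matrix.fromRows_mul_fromCols] at this
      simpa [hZH, Matrix.mul_assoc] using this
    have h2 : (σ - Z * ρ * Z).PosSemidef := by
      have h := (matSqrtInv_mul_mul_matSqrtInv_le_one hMp).mul_mul_conjTranspose_same s
      have e : s * (1 - N * M * N) * sᴴ = σ - Z * ρ * Z := by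
        rw [hsH, Matrix.mul_sub, Matrix.sub_mul, Matrix.mul_one, hs, matSqrt_mul_self hσ, ← hs]
        simp only [hZ, hM, Matrix.mul_assoc]
      rwa [← hN, e] at h
    have h3 : (Matrix.fromBlocks (0 : Matrix d d ℂ) 0 0 (σ - Z * ρ * Z)).PosSemidef := by
      have := h2.mul_mul_conjTranspose_same (Matrix.fromRows (0 : Matrix d d ℂ) (1 : Matrix d d ℂ))
      rw [Matrix.conjTranspose_fromRows_eq_fromCols_conjTranspose, Matrix.fromRows_mul,
        Matrix.fromRows_mul_fromCols] at this
      simpa using this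
    have h4 := h1.add h3
    rw [Matrix.fromBlocks_add] at h4
    simpa [hZH, hρ.1.eq] using h4
  · have h1 : (ρ * Z).trace = (M * N).trace := by
      rw [hZ, hM, ← Matrix.mul_assoc, Matrix.trace_mul_comm]
      simp only [Matrix.mul_assoc]
    have h2 : M * N = matSqrt M := by
      conv_lhs => enter [1]; rw [← hermCFC_id hMp.1]
      rw [hN, matSqrtInv, hermCFC_mul, matSqrt]
      refine hermCFC_congr hMp (fun x hx => ?_)
      rw [← div_eq_mul_inv, Real.div_sqrt]
    rw [h1, h2, fidelity]

lemma block_diag_nonneg {ρ σ X : Matrix d d ℂ} (h : (Matrix.fromBlocks ρ X Xᴴ σ).PosSemidef)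
    (P Q : Matrix d d ℂ) (t : ℝ) (i : d) :
    0 ≤ t ^ 2 * ((Pᴴ * ρ * P) i i).re + 2 * t * ((Pᴴ * X * Q) i i).re +
      ((Qᴴ * σ * Q) i i).re := by
  have h1 := h.conjTranspose_mul_mul_same (Matrix.fromRows ((t : ℂ) • P) Q)
  have h2 := (Complex.le_def.1 (h1.diag_nonneg (i := i))).1
  have e : ((Qᴴ * Xᴴ * P) i i).re = ((Pᴴ * X * Q) i i).re := by
    have : Qᴴ * Xᴴ * P = (Pᴴ * X * Q)ᴴ := by simp [Matrix.mul_assoc]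
    rw [this]
    simp [Matrix.conjTranspose_apply]
  rw [Matrix.conjTranspose_fromRows_eq_fromCols_conjTranspose, Matrix.fromCols_mul_fromBlocks,
    Matrix.fromCols_mul_fromRows] at h2
  simp [Matrix.add_mul] at h2
  rw [e] at h2
  nlinarith

lemma block_diag_re_sq_le {ρ σ X : Matrix d d ℂ}
    (h : (Matrix.fromBlocks ρ X Xᴴ σ).PosSemidef) (P Q : Matrix d d ℂ) (i : d) :
    ((Pᴴ * X * Q) i i).re ^ 2 ≤ ((Pᴴ * ρ * P) i i).re * ((Qᴴ * σ * Q) i i).re := by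
  have := discrim_le_zero (a := ((Pᴴ * ρ * P) i i).re) (b := 2 * ((Pᴴ * X * Q) i i).re)
    (c := ((Qᴴ * σ * Q) i i).re) (fun t => by
      have := block_diag_nonneg h P Q t i
      nlinarith)
  rw [discrim] at this
  nlinarith

lemma block_mul_eq_zero {ρ σ X : Matrix d d ℂ} (h : (Matrix.fromBlocks ρ X Xᴴ σ).PosSemidef)
    {Q : Matrix d d ℂ} (hQ : σ * Q = 0) : X * Q = 0 := by
  have h2 : ∀ i, (((X * Q)ᴴ * (X * Q)) i i).re = 0 := fun i => by
    have := block_diag_re_sq_le h (X * Q) Q i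
    rw [Matrix.mul_assoc Qᴴ, hQ] at this
    simp only [Matrix.zero_apply, Complex.zero_re, mul_zero] at this
    rw [← Matrix.mul_assoc]
    exact pow_eq_zero_iff two_ne_zero |>.1 (le_antisymm this (sq_nonneg _))
  rw [← Matrix.conjTranspose_mul_self_eq_zero,
    ← (Matrix.posSemidef_conjTranspose_mul_self (X * Q)).trace_eq_zero_iff]
  have h3 := (Complex.le_def.1 (Matrix.posSemidef_conjTranspose_mul_self (X * Q)).trace_nonneg).2
  apply Complex.ext
  · simp only [Matrix.trace, Matrix.diag_apply, Complex.re_sum, h2]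
    simp
  · exact h3.symm

/-- The trace of an off-diagonal block of a positive semidefinite block matrix is bounded
by the fidelity of the diagonal blocks. -/
lemma block_trace_le_fidelity {ρ σ X : Matrix d d ℂ} (hρ : ρ.PosSemidef) (hσ : σ.PosSemidef)
    (h : (Matrix.fromBlocks ρ X Xᴴ σ).PosSemidef) : X.trace.re ≤ fidelity ρ σ := by
  have hMp : (matSqrt σ * ρ * matSqrt σ).PosSemidef := posSemidef_matSqrt_conj hρ σ
  rw [fidelity_eq_sum hMp.1]
  set s := matSqrt σ with hs
  set r := matSqrtInv σ with hr
  have hsH : sᴴ = s := matSqrt_isHermitian σ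
  have hrH : rᴴ = r := matSqrtInv_isHermitian σ
  set V : Matrix d d ℂ := (hMp.1.eigenvectorUnitary : Matrix d d ℂ) with hV
  have hVV : V * Vᴴ = 1 := Unitary.coe_mul_star_self _
  have hVV' : Vᴴ * V = 1 := Unitary.coe_star_mul_self _
  have hX : X * (r * s) = X := by
    have : σ * (1 - r * s) = 0 := by
      conv_lhs => enter [1]; rw [← hermCFC_id hσ.1]
      rw [hr, hs, matSqrtInv, matSqrt, hermCFC_mul, ← hermCFC_one hσ.1, hermCFC_sub, hermCFC_mul,
        hermCFC_congr (g := fun _ => 0) hσ]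
      · simp [hermCFC]
      · intro x hx
        rcases hx.eq_or_lt with rfl | hx
        · simp
        · have := (Real.sqrt_pos.2 hx).ne'
          simp [this]
    have := block_mul_eq_zero h this
    rw [Matrix.mul_sub, Matrix.mul_one, sub_eq_zero] at this
    exact this.symm
  have ht : X.trace = ((s * V)ᴴ * X * (r * V)).trace := by
    have e : (s * V)ᴴ * X * (r * V) = Vᴴ * (s * X * r * V) := by
      simp [hsH, Matrix.mul_assoc]
    rw [e, Matrix.trace_mul_comm, Matrix.mul_assoc _ V, hVV, Matrix.mul_one, Matrix.mul_assoc,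
      Matrix.trace_mul_comm, Matrix.mul_assoc, hX]
  rw [ht, Matrix.trace, Complex.re_sum]
  refine Finset.sum_le_sum fun i _ => ?_
  have h1 := block_diag_re_sq_le h (s * V) (r * V) i
  have h2 : (((s * V)ᴴ * ρ * (s * V)) i i).re = hMp.1.eigenvalues i := by
    have e : (s * V)ᴴ * ρ * (s * V) = Vᴴ * (s * ρ * s) * V := by
      simp [hsH, Matrix.mul_assoc]
    rw [e, hV, conjTranspose_eigenvectorUnitary_mul_mul]
    simp
  have h3 : (((r * V)ᴴ * σ * (r * V)) i i).re ≤ 1 := by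
    have h4 := (matSqrtInv_mul_mul_matSqrtInv_le_one hσ).conjTranspose_mul_mul_same V
    have h5 := (Complex.le_def.1 (h4.diag_nonneg (i := i))).1
    have e : Vᴴ * (1 - r * σ * r) * V = 1 - (r * V)ᴴ * σ * (r * V) := by
      rw [Matrix.mul_sub, Matrix.sub_mul, Matrix.mul_one, hVV']
      simp [hrH, Matrix.mul_assoc]
    rw [← hr, e] at h5
    simpa using h5
  have h0 := hMp.eigenvalues_nonneg i
  rw [h2] at h1
  exact Real.le_sqrt_of_sq_le (h1.trans (mul_le_of_le_one_right h0 h3))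

lemma fidelity_le_half_trace_add {ρ σ : Matrix d d ℂ} (hρ : ρ.PosSemidef)
    (hσ : σ.PosSemidef) : fidelity ρ σ ≤ (ρ.trace.re + σ.trace.re) / 2 := by
  obtain ⟨X, hX, h⟩ := exists_block_trace_eq_fidelity hρ hσ
  rw [← h]
  have h1 : ∀ i, 2 * (X i i).re ≤ (ρ i i).re + (σ i i).re := fun i => by
    have := block_diag_nonneg hX 1 1 (-1) i
    simp at this
    linarith
  have h2 := Finset.sum_le_sum (fun i (_ : i ∈ Finset.univ) => h1 i)
  rw [← Finset.mul_sum, Finset.sum_add_distrib] at h2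
  simp only [Matrix.trace, Complex.re_sum, Matrix.diag_apply]
  linarith

/-- Monotonicity of the fidelity in the second argument, together with its scaling. -/
lemma fidelity_le_mul_fidelity {ρ A B : Matrix d d ℂ} (hρ : ρ.PosSemidef) (hA : A.PosSemidef)
    (hB : B.PosSemidef) {c : ℝ} (hc : 0 < c) (hAB : LoewnerLE A ((c ^ 2) • B)) :
    fidelity ρ A ≤ c * fidelity ρ B := by
  obtain ⟨X, hX, h⟩ := exists_block_trace_eq_fidelity hρ hA
  have hc' : (c : ℂ) ≠ 0 := by exact_mod_cast hc.ne'
  have h1 := (hX.add (hAB.mul_mul_conjTranspose_same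
    (Matrix.fromRows (0 : Matrix d d ℂ) (1 : Matrix d d ℂ)))).mul_mul_conjTranspose_same
      (Matrix.fromBlocks (1 : Matrix d d ℂ) 0 0 ((c : ℂ)⁻¹ • (1 : Matrix d d ℂ)))
  rw [Matrix.conjTranspose_fromRows_eq_fromCols_conjTranspose, Matrix.fromRows_mul,
    Matrix.fromRows_mul_fromCols, Matrix.fromBlocks_add, Matrix.fromBlocks_conjTranspose,
    Matrix.fromBlocks_multiply, Matrix.fromBlocks_multiply] at h1
  have e : (c : ℂ)⁻¹ • (c ^ 2) • (c : ℂ)⁻¹ • B = B := by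
    ext i j
    simp
    field_simp
  have h2 : (Matrix.fromBlocks ρ ((c : ℂ)⁻¹ • X) ((c : ℂ)⁻¹ • X)ᴴ B).PosSemidef := by
    simpa [e] using h1
  have h3 := block_trace_le_fidelity hρ hB h2
  rw [Matrix.trace_smul, smul_eq_mul, ← Complex.ofReal_inv, Complex.re_ofReal_mul, h,
    inv_mul_le_iff₀ hc] at h3
  exact h3

lemma ptrace2_eq_sum_submatrix {d₁ d₂ : Type*} [Fintype d₂]
    (M : Matrix (d₁ × d₂) (d₁ × d₂) ℂ) :
    ptrace2 M = ∑ k, M.submatrix (fun i => (i, k)) (fun i => (i, k)) := by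
  ext i j
  simp [ptrace2, Matrix.sum_apply]

lemma Matrix.PosSemidef.ptrace2 {d₁ d₂ : Type*} [Fintype d₁] [Fintype d₂]
    {M : Matrix (d₁ × d₂) (d₁ × d₂) ℂ} (hM : M.PosSemidef) : (ptrace2 M).PosSemidef := by
  rw [ptrace2_eq_sum_submatrix]
  exact Matrix.posSemidef_sum _ fun k _ => hM.submatrix _

lemma trace_ptrace2 {d₁ d₂ : Type*} [Fintype d₁] [Fintype d₂]
    (M : Matrix (d₁ × d₂) (d₁ × d₂) ℂ) : (ptrace2 M).trace = M.trace := by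
  simp [ptrace2, Matrix.trace, Fintype.sum_prod_type]

/-- Monotonicity of the fidelity under partial trace. -/
lemma fidelity_le_fidelity_ptrace2 {d₁ d₂ : Type*} [Fintype d₁] [Fintype d₂] [DecidableEq d₁]
    [DecidableEq d₂] {ρ σ : Matrix (d₁ × d₂) (d₁ × d₂) ℂ} (hρ : ρ.PosSemidef)
    (hσ : σ.PosSemidef) : fidelity ρ σ ≤ fidelity (ptrace2 ρ) (ptrace2 σ) := by
  obtain ⟨X, hX, h⟩ := exists_block_trace_eq_fidelity hρ hσ
  rw [← h, ← trace_ptrace2]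
  refine block_trace_le_fidelity hρ.ptrace2 hσ.ptrace2 ?_
  have e : Matrix.fromBlocks (ptrace2 ρ) (ptrace2 X) (ptrace2 X)ᴴ (ptrace2 σ) =
      ∑ k : d₂, (Matrix.fromBlocks ρ X Xᴴ σ).submatrix
        (Sum.map (fun i => (i, k)) (fun i => (i, k)))
        (Sum.map (fun i => (i, k)) (fun i => (i, k))) := by
    ext (i | i) (j | j) <;> simp [ptrace2, Matrix.sum_apply, Matrix.conjTranspose_apply]
  rw [e]
  exact Matrix.posSemidef_sum _ fun k _ => hX.submatrix _

/-- The fidelity can only grow under a relabelling of the index set. -/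
lemma fidelity_le_fidelity_submatrix {d' : Type*} [Fintype d'] [DecidableEq d']
    {ρ σ : Matrix d d ℂ} (hρ : ρ.PosSemidef) (hσ : σ.PosSemidef) (e : d' ≃ d) :
    fidelity ρ σ ≤ fidelity (ρ.submatrix e e) (σ.submatrix e e) := by
  obtain ⟨X, hX, h⟩ := exists_block_trace_eq_fidelity hρ hσ
  have ht : X.trace = (X.submatrix e e).trace := by
    simp [Matrix.trace, Equiv.sum_comp e (fun i => X i i)]
  rw [← h, ht]
  refine block_trace_le_fidelity (hρ.submatrix _) (hσ.submatrix _) ?_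
  convert hX.submatrix (Sum.map e e) using 1
  ext (i | i) (j | j) <;> simp [Matrix.conjTranspose_apply]

end FidelityBlocks

section RecoveryChannel

variable {R B C : Type} [Fintype R] [Fintype B] [Fintype C]

lemma margRB_posSemidef {ρ : Matrix (R × (B × C)) (R × (B × C)) ℂ} (hρ : ρ.PosSemidef) :
    (margRB ρ).PosSemidef :=
  Matrix.PosSemidef.ptrace2 (hρ.submatrix _)

variable [DecidableEq R]

lemma applyChannelR_posSemidef {ι : Type} [Fintype ι] (K : ι → Matrix (B × C) B ℂ)
    {X : Matrix (R × B) (R × B) ℂ} (hX : X.PosSemidef) : (applyChannelR K X).PosSemidef :=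
  Matrix.posSemidef_sum _ fun _ _ => hX.mul_mul_conjTranspose_same _

lemma trace_applyChannelR [DecidableEq B] {ι : Type} [Fintype ι] {K : ι → Matrix (B × C) B ℂ}
    (hK : ∑ i, (K i)ᴴ * K i = 1) (X : Matrix (R × B) (R × B) ℂ) :
    (applyChannelR K X).trace = X.trace := by
  have h : ∀ i, (((1 : Matrix R R ℂ) ⊗ₖ K i) * X * ((1 : Matrix R R ℂ) ⊗ₖ K i)ᴴ).trace =
      ((1 : Matrix R R ℂ) ⊗ₖ ((K i)ᴴ * K i) * X).trace := fun i => by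
    rw [Matrix.trace_mul_comm, ← Matrix.mul_assoc, Matrix.conjTranspose_kronecker,
      ← Matrix.mul_kronecker_mul, Matrix.conjTranspose_one, Matrix.one_mul]
  have h2 : ∑ i, (1 : Matrix R R ℂ) ⊗ₖ ((K i)ᴴ * K i) = 1 := by
    rw [← Matrix.one_kronecker_one (m := R) (n := B), ← hK]
    ext i j
    simp [Matrix.sum_apply, Finset.mul_sum]
  rw [applyChannelR, Matrix.trace_sum]
  simp only [h]
  rw [← Matrix.trace_sum, ← Finset.sum_mul, h2, Matrix.one_mul]

variable [DecidableEq B] [DecidableEq C]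

lemma fidelity_le_fidRecovery {ρ : Matrix (R × (B × C)) (R × (B × C)) ℂ} (hρ : ρ.PosSemidef)
    (ι : FinIdx) {K : ι.carrier → Matrix (B × C) B ℂ} (hK : ∑ i, (K i)ᴴ * K i = 1) :
    fidelity ρ (applyChannelR K (margRB ρ)) ≤ fidRecovery ρ := by
  refine le_csSup ⟨(ρ.trace.re + (margRB ρ).trace.re) / 2, ?_⟩ ⟨ι, K, hK, rfl⟩
  rintro _ ⟨κ, L, hL, rfl⟩
  rw [← trace_applyChannelR hL (margRB ρ)]
  exact fidelity_le_half_trace_add hρ (applyChannelR_posSemidef L (margRB_posSemidef hρ))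

/-- Adjoining a state `σ` on `C × T`, applying a unitary on `B × C × T` and tracing out `T`
is a quantum channel from `B` to `B × C`. -/
lemma exists_kraus_eq_ptrace2 {T : Type} [Fintype T] [DecidableEq T]
    (U : Matrix.unitaryGroup ((B × C) × T) ℂ) {σ : Matrix (C × T) (C × T) ℂ}
    (hσ : IsDensityMatrix σ) :
    ∃ K : T × (C × T) → Matrix (B × C) B ℂ, (∑ i, (K i)ᴴ * K i = 1) ∧
      ∀ X : Matrix (R × B) (R × B) ℂ, applyChannelR K X =
        ptrace2 ((((1 : Matrix R R ℂ) ⊗ₖ U.1) *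
          (Matrix.reindex (eRBCT R B C T) (eRBCT R B C T) (X ⊗ₖ σ)) *
          ((1 : Matrix R R ℂ) ⊗ₖ U.1)ᴴ).submatrix
            (Equiv.prodAssoc R (B × C) T) (Equiv.prodAssoc R (B × C) T)) := by
  set s := matSqrt σ with hs
  have hsH : sᴴ = s := matSqrt_isHermitian σ
  have hss : σ = s * sᴴ := by rw [hsH, hs, matSqrt_mul_self hσ.1]
  let J : C × T → Matrix ((B × C) × T) B ℂ :=
    fun j => Matrix.of fun x b => if x.1.1 = b then s (x.1.2, x.2) j else 0
  have hJ : ∑ j, (J j)ᴴ * J j = 1 := by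
    have h1 : ∑ j, (J j)ᴴ * J j = σ.trace • (1 : Matrix B B ℂ) := by
      have h2 : σ.trace = ∑ j, ∑ c, ∑ t, star (s (c, t) j) * s (c, t) j := by
        rw [hss, Matrix.trace_mul_comm]
        simp [Matrix.trace, Matrix.mul_apply, Matrix.conjTranspose_apply, Fintype.sum_prod_type]
      rw [h2]
      ext b b'
      by_cases hb : b = b'
      · subst hb
        simp [J, Matrix.sum_apply, Matrix.mul_apply, Fintype.sum_prod_type, apply_ite]
      · simp [J, Matrix.sum_apply, Matrix.mul_apply, Fintype.sum_prod_type, apply_ite, hb]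
        exact fun h => absurd h.symm hb
    rw [h1, hσ.2, one_smul]
  have hJX : ∀ X : Matrix (R × B) (R × B) ℂ,
      ∑ j, ((1 : Matrix R R ℂ) ⊗ₖ J j) * X * ((1 : Matrix R R ℂ) ⊗ₖ J j)ᴴ =
        Matrix.reindex (eRBCT R B C T) (eRBCT R B C T) (X ⊗ₖ σ) := by
    intro X
    rw [hss]
    ext ⟨r, ⟨b, c⟩, t⟩ ⟨r', ⟨b', c'⟩, t'⟩
    simp [J, Matrix.sum_apply, Matrix.mul_apply, Matrix.one_apply, eRBCT, Fintype.sum_prod_type]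
    simp only [apply_ite (starRingEnd ℂ), map_zero, mul_ite, mul_zero, Finset.sum_ite_eq,
      Finset.mem_univ, if_true, Finset.mul_sum]
    refine Finset.sum_congr rfl fun _ _ => Finset.sum_congr rfl fun _ _ => ?_
    ring
  refine ⟨fun i => (U.1 * J i.2).submatrix (fun x => (x, i.1)) id, ?_, fun X => ?_⟩
  · have hU : (U.1)ᴴ * U.1 = 1 := Unitary.coe_star_mul_self U
    have h : ∀ j, ∑ t : T, ((U.1 * J j).submatrix (fun x => (x, t)) id)ᴴ *
        (U.1 * J j).submatrix (fun x => (x, t)) id = (J j)ᴴ * J j := fun j => by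
      have e : (J j)ᴴ * J j = (U.1 * J j)ᴴ * (U.1 * J j) := by
        rw [Matrix.conjTranspose_mul, Matrix.mul_assoc, ← Matrix.mul_assoc _ U.1, hU,
          Matrix.one_mul]
      rw [e]
      ext b b'
      simp only [Matrix.sum_apply, Matrix.mul_apply (M := (Matrix.submatrix _ _ _)ᴴ),
        Matrix.mul_apply (M := (U.1 * J j)ᴴ)]
      rw [Fintype.sum_prod_type_right]
      rfl
    rw [Fintype.sum_prod_type_right, ← hJ]
    exact Finset.sum_congr rfl fun j _ => h j
  · rw [ptrace2_eq_sum_submatrix, ← hJX X, applyChannelR, Fintype.sum_prod_type]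
    refine Finset.sum_congr rfl fun t _ => ?_
    rw [Finset.mul_sum, Finset.sum_mul]
    ext x y
    simp only [Matrix.sum_apply, Matrix.submatrix_apply]
    refine Finset.sum_congr rfl fun j _ => ?_
    have e : ((1 : Matrix R R ℂ) ⊗ₖ U.1) *
        (((1 : Matrix R R ℂ) ⊗ₖ J j) * X * ((1 : Matrix R R ℂ) ⊗ₖ J j)ᴴ) *
        ((1 : Matrix R R ℂ) ⊗ₖ U.1)ᴴ =
        ((1 : Matrix R R ℂ) ⊗ₖ (U.1 * J j)) * X * ((1 : Matrix R R ℂ) ⊗ₖ (U.1 * J j))ᴴ := by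
      conv_rhs => rw [← Matrix.one_mul (1 : Matrix R R ℂ), Matrix.mul_kronecker_mul]
      rw [Matrix.conjTranspose_mul]
      simp only [Matrix.mul_assoc]
    rw [e]
    rfl

end RecoveryChannel

lemma ptrace2_reindex_prodAssoc_kronecker {R D T : Type*} [Fintype T]
    (ρ : Matrix (R × D) (R × D) ℂ) {σ : Matrix T T ℂ} (hσ : σ.trace = 1) :
    ptrace2 ((Matrix.reindex (Equiv.prodAssoc R D T) (Equiv.prodAssoc R D T)
      (ρ ⊗ₖ σ)).submatrix (Equiv.prodAssoc R D T) (Equiv.prodAssoc R D T)) = ρ := by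
  ext i j
  simp only [ptrace2, Matrix.reindex_apply, Matrix.submatrix_apply, Equiv.symm_apply_apply,
    Matrix.kroneckerMap_apply]
  rw [← Finset.mul_sum]
  exact (congrArg _ hσ).trans (mul_one _)

/-- **Recovery lower bound on Q^ε:**
`Q^ε(Ψ_RABC) ≥ −2·log F(R:C|B)_{Ψ_RBC} + log(1 − ε²)`. -/
theorem Qeps_ge_fidRecovery {R A B C : Type}
    [Fintype R] [Fintype A] [Fintype B] [Fintype C]
    [DecidableEq R] [DecidableEq A] [DecidableEq B] [DecidableEq C]
    [Nonempty R] [Nonempty A] [Nonempty B] [Nonempty C]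
    (ε : ℝ) (hε0 : 0 < ε) (hε1 : ε < 1)
    (ψ : (R × (B × C)) × A → ℂ) (hψ : ∑ i, ‖ψ i‖ ^ 2 = 1) :
    Qeps ε ψ ≥
      ((-2 * Real.logb 2 (fidRecovery (ptrace2 (Matrix.vecMulVec ψ (star ψ))))
          + Real.logb 2 (1 - ε ^ 2) : ℝ) : EReal) := by
  have hρ : (ptrace2 (Matrix.vecMulVec ψ (star ψ))).PosSemidef :=
    (Matrix.posSemidef_vecMulVec_self_star ψ).ptrace2
  refine le_iInf fun T => le_iInf fun U => le_iInf fun σ' => le_iInf fun σCT =>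
    le_iInf fun κ => le_iInf fun hκ => le_iInf fun hball => le_sInf ?_
  rintro _ ⟨l, rfl, hl⟩
  rw [EReal.coe_le_coe_iff]
  set ρ := ptrace2 (Matrix.vecMulVec ψ (star ψ)) with hρdef
  change ptrace2 κ.1 = margRB ρ at hκ
  obtain ⟨K, hK, hKX⟩ := exists_kraus_eq_ptrace2 (R := R) U σCT.2
  have hrec := fidelity_le_fidRecovery hρ ⟨T.carrier × (C × T.carrier)⟩ hK
  rw [hKX] at hrec
  rw [hκ] at hl
  obtain ⟨⟨hω, -⟩, hdist⟩ := hball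
  set W : Matrix (R × ((B × C) × T.carrier)) (R × ((B × C) × T.carrier)) ℂ :=
    (1 : Matrix R R ℂ) ⊗ₖ U.1 with hW
  set P := Matrix.reindex (Equiv.prodAssoc R (B × C) T.carrier)
    (Equiv.prodAssoc R (B × C) T.carrier) (ρ ⊗ₖ σ'.1) with hP
  set τ := W * (Matrix.reindex (eRBCT R B C T.carrier) (eRBCT R B C T.carrier)
    (margRB ρ ⊗ₖ σCT.1)) * Wᴴ with hτ
  set ω := W * (Matrix.reindex (eRBCT R B C T.carrier) (eRBCT R B C T.carrier) κ.1) * Wᴴ with hωdef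
  have hPp : P.PosSemidef := (hρ.kronecker σ'.2.1).submatrix _
  have hτp : τ.PosSemidef :=
    (((margRB_posSemidef hρ).kronecker σCT.2.1).submatrix _).mul_mul_conjTranspose_same _
  set c : ℝ := (2 : ℝ) ^ (l / 2) with hc
  have hc0 : 0 < c := Real.rpow_pos_of_pos two_pos _
  have hc2 : c ^ 2 = (2 : ℝ) ^ l := by
    rw [hc, ← Real.rpow_natCast, ← Real.rpow_mul two_pos.le]
    congr 1
    push_cast
    ring
  have hωτ : LoewnerLE ω ((c ^ 2) • τ) := by
    have h := (hl.submatrix (eRBCT R B C T.carrier).symm).mul_mul_conjTranspose_same W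
    rw [LoewnerLE, hc2]
    convert h using 1
    rw [hτ, hωdef, ← Matrix.smul_mul, ← Matrix.mul_smul, ← Matrix.sub_mul, ← Matrix.mul_sub]
    rfl
  have h1 := fidelity_le_mul_fidelity hPp hω hτp hc0 hωτ
  have h2 := fidelity_le_fidelity_submatrix hPp hτp (Equiv.prodAssoc R (B × C) T.carrier)
  have h3 := fidelity_le_fidelity_ptrace2
    (hPp.submatrix (Equiv.prodAssoc R (B × C) T.carrier))
    (hτp.submatrix (Equiv.prodAssoc R (B × C) T.carrier))
  rw [hP, ptrace2_reindex_prodAssoc_kronecker ρ σ'.2.2, ← hP] at h3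
  have h4 : fidelity P ω ≤ c * fidRecovery ρ :=
    h1.trans (mul_le_mul_of_nonneg_left ((h2.trans h3).trans hrec) hc0.le)
  have hF0 : 0 ≤ fidelity P ω := by
    rw [fidelity_eq_sum (posSemidef_matSqrt_conj hPp ω).1]
    exact Finset.sum_nonneg fun _ _ => Real.sqrt_nonneg _
  have h5 : 1 - ε ^ 2 ≤ fidelity P ω ^ 2 := by
    have := (Real.sqrt_le_left hε0.le).1 hdist
    linarith
  have h6 : 0 < 1 - ε ^ 2 := by nlinarith
  have h7 : 1 - ε ^ 2 ≤ c ^ 2 * fidRecovery ρ ^ 2 := by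
    rw [← mul_pow]
    exact h5.trans (pow_le_pow_left₀ hF0 h4 2)
  have h8 : fidRecovery ρ ≠ 0 := by
    intro h
    rw [h, zero_pow two_ne_zero, mul_zero] at h7
    linarith
  have h9 := Real.logb_le_logb_of_le one_lt_two h6 h7
  rw [hc2, Real.logb_mul (by positivity) (by positivity), Real.logb_rpow two_pos (by norm_num),
    Real.logb_pow] at h9
  push_cast at h9
  linarith

end
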